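/- Let n ≥ 1 and let p⃗, s⃗ be n-tuples with 1 ≤ pᵢ, sᵢ ≤ ∞. There exist constants 0 < c ≤ C, independent of f and of r, such that for all r > 0 and all locally integrable f on ℝⁿ: c·r^{−Σᵢ 1/sᵢ}·‖ y ↦ ‖f·χ_{B(y,r)}‖_{L^{p⃗}} ‖_{L^{s⃗}} ≤ ‖ {‖f·χ_{Q_{r,k}}‖_{L^{p⃗}}}_{k∈ℤⁿ} ‖_{ℓ^{s⃗}} ≤ C·r^{−Σᵢ 1/sᵢ}·‖ y ↦ ‖f·χ_{B(y,r)}‖_{L^{p⃗}} ‖_{L^{s⃗}}. -/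

import Mathlib

open MeasureTheory ENNReal Filter Topology Set

noncomputable section

namespace MixedAmalgam

/-- `L^p` norm over `ℝ` of an `ℝ≥0∞`-valued function, with the usual
modification (`essSup`) for `p = ∞`. -/
def lpInt (p : ℝ≥0∞) (g : ℝ → ℝ≥0∞) : ℝ≥0∞ :=
  if p = ∞ then essSup g volume else (∫⁻ t, g t ^ p.toReal) ^ (1 / p.toReal)

/-- `ℓ^p` norm over `ℤ` of an `ℝ≥0∞`-valued family, with the usual
modification for `p = ∞`. -/
def lpSum (p : ℝ≥0∞) (g : ℤ → ℝ≥0∞) : ℝ≥0∞ :=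
  if p = ∞ then ⨆ k, g k else (∑' k, g k ^ p.toReal) ^ (1 / p.toReal)

/-- Iterated mixed Lebesgue norm of an `ℝ≥0∞`-valued function on `ℝⁿ`,
taking the `L^{p₁}` norm in the first variable innermost, and the `L^{pₙ}`
norm in the last variable outermost. -/
def mixedE : (n : ℕ) → (Fin n → ℝ≥0∞) → ((Fin n → ℝ) → ℝ≥0∞) → ℝ≥0∞
  | 0, _, g => g Fin.elim0
  | n + 1, p, g =>
    lpInt (p (Fin.last n)) fun t =>
      mixedE n (fun i => p i.castSucc) fun x => g (Fin.snoc x t)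

/-- Mixed-norm Lebesgue norm `‖f‖_{L^{p⃗}}` of a real-valued function on `ℝⁿ`. -/
def mixedLp (n : ℕ) (p : Fin n → ℝ≥0∞) (f : (Fin n → ℝ) → ℝ) : ℝ≥0∞ :=
  mixedE n p fun x => (‖f x‖₊ : ℝ≥0∞)

/-- Iterated mixed `ℓ^{s⃗}` norm of an `ℝ≥0∞`-valued family indexed by `ℤⁿ`. -/
def mixedSeq : (n : ℕ) → (Fin n → ℝ≥0∞) → ((Fin n → ℤ) → ℝ≥0∞) → ℝ≥0∞
  | 0, _, a => a Fin.elim0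
  | n + 1, s, a =>
    lpSum (s (Fin.last n)) fun k =>
      mixedSeq n (fun i => s i.castSucc) fun m => a (Fin.snoc m k)

/-- Open Euclidean ball of center `y` and radius `r` in `ℝⁿ`. -/
def eball (n : ℕ) (y : Fin n → ℝ) (r : ℝ) : Set (Fin n → ℝ) :=
  {x | Real.sqrt (∑ i, (x i - y i) ^ 2) < r}

/-- `Σᵢ 1/pᵢ` as a real number. -/
def invSum (n : ℕ) (p : Fin n → ℝ≥0∞) : ℝ :=
  ∑ i, (1 / p i).toReal

/-- The `(L^{p⃗},L^{s⃗})` amalgam norm computed with balls of radius `r`. -/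
def amalgamNormR (n : ℕ) (p s : Fin n → ℝ≥0∞) (r : ℝ) (f : (Fin n → ℝ) → ℝ) : ℝ≥0∞ :=
  mixedE n s fun y => mixedLp n p ((eball n y r).indicator f)

/-- The amalgam norm `‖f‖_{(L^{p⃗},L^{s⃗})}`. -/
def amalgamNorm (n : ℕ) (p s : Fin n → ℝ≥0∞) (f : (Fin n → ℝ) → ℝ) : ℝ≥0∞ :=
  amalgamNormR n p s 1 f

/-- The amalgam norm `‖f‖_{(L^{p⃗},L^{s⃗})^α}`. -/
def amalgamNormA (n : ℕ) (p s : Fin n → ℝ≥0∞) (α : ℝ≥0∞) (f : (Fin n → ℝ) → ℝ) : ℝ≥0∞ :=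
  ⨆ (r : ℝ) (_ : 0 < r),
    mixedE n s fun y =>
      volume (eball n y r) ^
          ((1 / α).toReal - invSum n p / (n : ℝ) - invSum n s / (n : ℝ)) *
        mixedLp n p ((eball n y r).indicator f)

/-- The amalgam norm `‖·‖_{(L^{p⃗},L^{s⃗})^α}` for `ℝ≥0∞`-valued functions. -/
def amalgamNormAE (n : ℕ) (p s : Fin n → ℝ≥0∞) (α : ℝ≥0∞)
    (g : (Fin n → ℝ) → ℝ≥0∞) : ℝ≥0∞ :=
  ⨆ (r : ℝ) (_ : 0 < r),
    mixedE n s fun y =>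
      volume (eball n y r) ^
          ((1 / α).toReal - invSum n p / (n : ℝ) - invSum n s / (n : ℝ)) *
        mixedE n p ((eball n y r).indicator g)

/-- The cube `Q_{r,k} = r(k + [0,1)ⁿ)`. -/
def qcube (n : ℕ) (r : ℝ) (k : Fin n → ℤ) : Set (Fin n → ℝ) :=
  {x | ∀ i, r * (k i : ℝ) ≤ x i ∧ x i < r * ((k i : ℝ) + 1)}

/-- The discrete amalgam norm `_r‖f‖_{p⃗,s⃗}`. -/
def discNormR (n : ℕ) (p s : Fin n → ℝ≥0∞) (r : ℝ) (f : (Fin n → ℝ) → ℝ) : ℝ≥0∞ :=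
  mixedSeq n s fun k => mixedLp n p ((qcube n r k).indicator f)

/-- The discrete amalgam norm `‖f‖_{p⃗,s⃗} = _1‖f‖_{p⃗,s⃗}`. -/
def discNorm (n : ℕ) (p s : Fin n → ℝ≥0∞) (f : (Fin n → ℝ) → ℝ) : ℝ≥0∞ :=
  discNormR n p s 1 f

/-- The discrete amalgam norm
`‖f‖_{p⃗,s⃗,α} = sup_{r>0} r^{n/α - Σᵢ 1/pᵢ} · _r‖f‖_{p⃗,s⃗}`. -/
def discNormA (n : ℕ) (p s : Fin n → ℝ≥0∞) (α : ℝ≥0∞) (f : (Fin n → ℝ) → ℝ) : ℝ≥0∞ :=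
  ⨆ (r : ℝ) (_ : 0 < r),
    ENNReal.ofReal (r ^ ((n : ℝ) * (1 / α).toReal - invSum n p)) * discNormR n p s r f

/-- Membership in `(L^{p⃗},L^{s⃗})^α(ℝⁿ)` (continuous form). -/
def memA (n : ℕ) (p s : Fin n → ℝ≥0∞) (α : ℝ≥0∞) (f : (Fin n → ℝ) → ℝ) : Prop :=
  LocallyIntegrable f volume ∧ amalgamNormA n p s α f < ∞

/-- Membership in `(L^{p⃗},ℓ^{s⃗})(ℝⁿ)`. -/
def memD (n : ℕ) (p s : Fin n → ℝ≥0∞) (f : (Fin n → ℝ) → ℝ) : Prop :=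
  LocallyIntegrable f volume ∧ discNorm n p s f < ∞

/-- Membership in `(L^{p⃗},ℓ^{s⃗})^α(ℝⁿ)`. -/
def memDA (n : ℕ) (p s : Fin n → ℝ≥0∞) (α : ℝ≥0∞) (f : (Fin n → ℝ) → ℝ) : Prop :=
  LocallyIntegrable f volume ∧ discNormA n p s α f < ∞

/-- The dilation `St_r^{(α)} f = r^{-n/α} f(r⁻¹ ·)`. -/
def dil (n : ℕ) (α : ℝ≥0∞) (r : ℝ) (f : (Fin n → ℝ) → ℝ) : (Fin n → ℝ) → ℝ :=
  fun x => r ^ (-((n : ℝ) * (1 / α).toReal)) * f (r⁻¹ • x)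

/-- A block decomposition `f = Σ_j c_j St_{r_j}^{(α')} f_j` converging in `L¹_loc`. -/
structure BlockDecomp (n : ℕ) (p' s' : Fin n → ℝ≥0∞) (α' : ℝ≥0∞) (f : (Fin n → ℝ) → ℝ)
    (c : ℕ → ℝ) (rr : ℕ → ℝ) (g : ℕ → (Fin n → ℝ) → ℝ) : Prop where
  csummable : Summable fun j => |c j|
  rpos : ∀ j, 0 < rr j
  gloc : ∀ j, LocallyIntegrable (g j) volume
  gnorm : ∀ j, discNorm n p' s' (g j) ≤ 1
  conv : ∀ K : Set (Fin n → ℝ), IsCompact K →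
    Tendsto (fun J : ℕ =>
        ∫⁻ x in K,
          (‖f x - ∑ j ∈ Finset.range J, c j * dil n α' (rr j) (g j) x‖₊ : ℝ≥0∞))
      atTop (𝓝 0)

/-- Membership in the block space `H(p⃗',s⃗',α')`. -/
def memH (n : ℕ) (p' s' : Fin n → ℝ≥0∞) (α' : ℝ≥0∞) (f : (Fin n → ℝ) → ℝ) : Prop :=
  LocallyIntegrable f volume ∧ ∃ c rr g, BlockDecomp n p' s' α' f c rr g

/-- The norm of the block space `H(p⃗',s⃗',α')`. -/
def hNorm (n : ℕ) (p' s' : Fin n → ℝ≥0∞) (α' : ℝ≥0∞) (f : (Fin n → ℝ) → ℝ) : ℝ≥0∞ :=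
  ⨅ (c : ℕ → ℝ) (rr : ℕ → ℝ) (g : ℕ → (Fin n → ℝ) → ℝ)
    (_ : BlockDecomp n p' s' α' f c rr g), ENNReal.ofReal (∑' j, |c j|)

/-- The fractional integral operator `I_γ`. -/
def fracInt (n : ℕ) (γ : ℝ) (f : (Fin n → ℝ) → ℝ) : (Fin n → ℝ) → ℝ :=
  fun x => ∫ y, f y / Real.sqrt (∑ i, (x i - y i) ^ 2) ^ ((n : ℝ) - γ)

/-- The fractional maximal operator `M_γ`. -/
def fracMax (n : ℕ) (γ : ℝ) (f : (Fin n → ℝ) → ℝ) : (Fin n → ℝ) → ℝ≥0∞ :=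
  fun x => ⨆ (y : Fin n → ℝ) (r : ℝ) (_ : 0 < r) (_ : x ∈ eball n y r),
    volume (eball n y r) ^ (γ / (n : ℝ) - 1) * ∫⁻ z in eball n y r, (‖f z‖₊ : ℝ≥0∞)

/-- The commutator `[b, I_γ] f`. -/
def commFracInt (n : ℕ) (γ : ℝ) (b f : (Fin n → ℝ) → ℝ) : (Fin n → ℝ) → ℝ :=
  fun x => ∫ y, (b x - b y) * f y / Real.sqrt (∑ i, (x i - y i) ^ 2) ^ ((n : ℝ) - γ)

/-- The mean value `b_B` of `b` over the ball `B(y,r)`. -/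
def ballAvg (n : ℕ) (b : (Fin n → ℝ) → ℝ) (y : Fin n → ℝ) (r : ℝ) : ℝ :=
  (volume (eball n y r)).toReal⁻¹ * ∫ x in eball n y r, b x

/-- The `BMO` norm `sup_B (1/|B|) ∫_B |b - b_B|`. -/
def bmoNorm (n : ℕ) (b : (Fin n → ℝ) → ℝ) : ℝ≥0∞ :=
  ⨆ (y : Fin n → ℝ) (r : ℝ) (_ : 0 < r),
    ENNReal.ofReal
      ((volume (eball n y r)).toReal⁻¹ * ∫ x in eball n y r, |b x - ballAvg n b y r|)

lemma lpInt_eq {p : ℝ≥0∞} (hp : 1 ≤ p) (g : ℝ → ℝ≥0∞) : lpInt p g = eLpNorm g p volume := by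
  have h0 : p ≠ 0 := fun h => by simp [h] at hp
  by_cases h : p = ∞
  · simp [lpInt, h, eLpNorm_exponent_top, eLpNormEssSup, enorm_eq_self]
  · simp [lpInt, h, eLpNorm_eq_lintegral_rpow_enorm_toReal h0 h, enorm_eq_self]

lemma lpSum_eq {p : ℝ≥0∞} (hp : 1 ≤ p) (g : ℤ → ℝ≥0∞) :
    lpSum p g = eLpNorm g p Measure.count := by
  have h0 : p ≠ 0 := fun h => by simp [h] at hp
  by_cases h : p = ∞
  · simp [lpSum, h, eLpNorm_exponent_top, eLpNormEssSup, enorm_eq_self]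
  · simp [lpSum, h, eLpNorm_eq_lintegral_rpow_enorm_toReal h0 h, enorm_eq_self, lintegral_count]

lemma lpInt_mono_ae {p : ℝ≥0∞} (hp : 1 ≤ p) {g h : ℝ → ℝ≥0∞} (H : ∀ᵐ t, g t ≤ h t) :
    lpInt p g ≤ lpInt p h := by
  rw [lpInt_eq hp, lpInt_eq hp]
  exact eLpNorm_mono_enorm_ae (by simpa [enorm_eq_self] using H)

lemma lpSum_mono {p : ℝ≥0∞} (hp : 1 ≤ p) {g h : ℤ → ℝ≥0∞} (H : ∀ t, g t ≤ h t) :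
    lpSum p g ≤ lpSum p h := by
  rw [lpSum_eq hp, lpSum_eq hp]
  exact eLpNorm_mono_enorm_ae (Eventually.of_forall (by simpa [enorm_eq_self] using H))

lemma lpInt_const_mul {p : ℝ≥0∞} {c : ℝ≥0∞} (hc : c ≠ ∞) (hp : 1 ≤ p) (g : ℝ → ℝ≥0∞) :
    lpInt p (fun t => c * g t) = c * lpInt p g := by
  have h0 : p ≠ 0 := fun h => by simp [h] at hp
  by_cases h : p = ∞
  · simp [lpInt, h, ENNReal.essSup_const_mul]
  · have hq : 0 < p.toReal := ENNReal.toReal_pos h0 h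
    simp only [lpInt, h, if_false]
    simp_rw [ENNReal.mul_rpow_of_nonneg _ _ hq.le]
    rw [lintegral_const_mul' _ _ (ENNReal.rpow_ne_top_of_nonneg hq.le hc),
      ENNReal.mul_rpow_of_nonneg _ _ (by positivity), ← ENNReal.rpow_mul,
      mul_one_div_cancel hq.ne', ENNReal.rpow_one]

lemma map_floor {r : ℝ} (hr : 0 < r) :
    Measure.map (fun t : ℝ => ⌊t / r⌋) volume = ENNReal.ofReal r • Measure.count := by
  rw [Measure.ext_iff_singleton]
  intro k
  rw [Measure.map_apply (by fun_prop) (measurableSet_singleton k)]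
  have : (fun t : ℝ => ⌊t / r⌋) ⁻¹' {k} = Ico (r * k) (r * (k + 1)) := by
    ext t
    simp only [mem_preimage, mem_singleton_iff, Int.floor_eq_iff, mem_Ico, le_div_iff₀ hr,
      div_lt_iff₀ hr, mul_comm r]
  rw [this, Real.volume_Ico]
  simp only [Measure.smul_apply, Measure.count_singleton, smul_eq_mul, mul_one]
  congr 1; ring

lemma lpInt_step {p : ℝ≥0∞} (hp : 1 ≤ p) {r : ℝ} (hr : 0 < r) (a : ℤ → ℝ≥0∞) :
    lpInt p (fun t => a ⌊t / r⌋) = ENNReal.ofReal (r ^ (1 / p).toReal) * lpSum p a := by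
  rw [lpInt_eq hp, lpSum_eq hp]
  have h1 := eLpNorm_map_measure (p := p) (μ := (volume : Measure ℝ)) (g := a)
    (f := fun t : ℝ => ⌊t / r⌋) (measurable_of_countable a).aestronglyMeasurable
    (by fun_prop)
  rw [map_floor hr, eLpNorm_smul_measure_of_ne_zero (by simpa using hr)] at h1
  rw [← ENNReal.ofReal_rpow_of_pos hr]
  exact h1.symm

lemma mixedE_step {r : ℝ} (hr : 0 < r) : ∀ (n : ℕ) (s : Fin n → ℝ≥0∞) (_ : ∀ i, 1 ≤ s i)
    (a : (Fin n → ℤ) → ℝ≥0∞),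
    mixedE n s (fun y => a (fun i => ⌊y i / r⌋)) =
      ENNReal.ofReal (r ^ invSum n s) * mixedSeq n s a
  | 0, s, _, a => by
    simp only [mixedE, mixedSeq, invSum]
    simp
    congr 1
    exact Subsingleton.elim _ _
  | n + 1, s, hs, a => by
    have key : ∀ (t : ℝ) (x : Fin n → ℝ),
        (fun i => ⌊(Fin.snoc x t : Fin (n+1) → ℝ) i / r⌋) =
          (Fin.snoc (fun i => ⌊x i / r⌋) ⌊t / r⌋ : Fin (n+1) → ℤ) := by
      intro t x
      ext i
      refine Fin.lastCases ?_ (fun j => ?_) i <;> simp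
    simp only [mixedE, mixedSeq]
    simp_rw [key]
    have ih := fun k : ℤ => mixedE_step hr n (fun i => s i.castSucc) (fun i => hs _)
      (fun m => a (Fin.snoc m k))
    simp_rw [ih]
    rw [lpInt_const_mul ENNReal.ofReal_ne_top (hs _),
      lpInt_step (hs _) hr (fun k => mixedSeq n (fun i => s i.castSucc) fun m => a (Fin.snoc m k)),
      ← mul_assoc, ← ENNReal.ofReal_mul (by positivity), ← Real.rpow_add hr]
    congr 3
    simp [invSum, Fin.sum_univ_castSucc]

lemma mixedSeq_mono : ∀ (n : ℕ) (s : Fin n → ℝ≥0∞) (_ : ∀ i, 1 ≤ s i)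
    {a b : (Fin n → ℤ) → ℝ≥0∞} (_ : ∀ k, a k ≤ b k), mixedSeq n s a ≤ mixedSeq n s b
  | 0, _, _, _, _, h => h _
  | n + 1, _, hs, _, _, h =>
    lpSum_mono (hs _) fun _ => mixedSeq_mono n _ (fun _ => hs _) fun _ => h _

lemma mixedSeq_add : ∀ (n : ℕ) (s : Fin n → ℝ≥0∞) (_ : ∀ i, 1 ≤ s i)
    (a b : (Fin n → ℤ) → ℝ≥0∞),
    mixedSeq n s (fun k => a k + b k) ≤ mixedSeq n s a + mixedSeq n s b
  | 0, _, _, _, _ => le_rfl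
  | n + 1, s, hs, a, b => by
    simp only [mixedSeq]
    refine (lpSum_mono (hs _) fun k => mixedSeq_add n _ (fun _ => hs _) _ _).trans ?_
    rw [lpSum_eq (hs _), lpSum_eq (hs _), lpSum_eq (hs _)]
    exact eLpNorm_add_le (measurable_of_countable _).aestronglyMeasurable
      (measurable_of_countable _).aestronglyMeasurable (hs _)

lemma lpSum_zero {p : ℝ≥0∞} (hp : 1 ≤ p) : lpSum p (fun _ => 0) = 0 := by
  rw [lpSum_eq hp]
  exact eLpNorm_zero

lemma lpInt_zero {p : ℝ≥0∞} (hp : 1 ≤ p) : lpInt p (fun _ => 0) = 0 := by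
  rw [lpInt_eq hp]
  exact eLpNorm_zero

lemma mixedSeq_zero : ∀ (n : ℕ) (s : Fin n → ℝ≥0∞) (_ : ∀ i, 1 ≤ s i),
    mixedSeq n s (fun _ => 0) = 0
  | 0, _, _ => rfl
  | n + 1, s, hs => by
    simp only [mixedSeq]
    simp_rw [mixedSeq_zero n _ (fun i => hs i.castSucc)]
    exact lpSum_zero (hs _)

lemma mixedE_zero : ∀ (n : ℕ) (s : Fin n → ℝ≥0∞) (_ : ∀ i, 1 ≤ s i),
    mixedE n s (fun _ => 0) = 0
  | 0, _, _ => rfl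
  | n + 1, s, hs => by
    simp only [mixedE]
    simp_rw [mixedE_zero n _ (fun i => hs i.castSucc)]
    exact lpInt_zero (hs _)

lemma mixedSeq_sum {ι : Type*} (n : ℕ) (s : Fin n → ℝ≥0∞) (hs : ∀ i, 1 ≤ s i)
    (J : Finset ι) (a : ι → (Fin n → ℤ) → ℝ≥0∞) :
    mixedSeq n s (fun k => ∑ j ∈ J, a j k) ≤ ∑ j ∈ J, mixedSeq n s (a j) := by
  classical
  induction J using Finset.induction_on with
  | empty => simp [mixedSeq_zero n s hs]
  | insert i J hi ih =>
    simp_rw [Finset.sum_insert hi]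
    exact (mixedSeq_add n s hs _ _).trans (by gcongr)

lemma lpSum_comp {p : ℝ≥0∞} {φ : ℤ → ℤ} (hφ : Function.Injective φ) (a : ℤ → ℝ≥0∞) :
    lpSum p (fun k => a (φ k)) ≤ lpSum p a := by
  unfold lpSum
  split_ifs
  · exact iSup_comp_le a φ
  · refine ENNReal.rpow_le_rpow ?_ (by positivity)
    exact ENNReal.tsum_comp_le_tsum_of_injective hφ (fun k => a k ^ p.toReal)

lemma mixedSeq_comp {M : ℤ} (hM : 0 < M) : ∀ (n : ℕ) (s : Fin n → ℝ≥0∞) (_ : ∀ i, 1 ≤ s i)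
    (j : Fin n → ℤ) (a : (Fin n → ℤ) → ℝ≥0∞),
    mixedSeq n s (fun k => a (fun i => M * k i + j i)) ≤ mixedSeq n s a
  | 0, _, _, _, a => by
    simp only [mixedSeq]
    exact le_of_eq (congrArg a (Subsingleton.elim _ _))
  | n + 1, s, hs, j, a => by
    have key : ∀ (t : ℤ) (x : Fin n → ℤ),
        (fun i => M * (Fin.snoc x t : Fin (n+1) → ℤ) i + j i) =
          (Fin.snoc (fun i => M * x i + j i.castSucc) (M * t + j (Fin.last n)) :
            Fin (n+1) → ℤ) := by
      intro t x
      ext i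
      refine Fin.lastCases ?_ (fun j => ?_) i <;> simp
    simp only [mixedSeq]
    simp_rw [key]
    refine (lpSum_mono (hs _) fun k => mixedSeq_comp hM n _ (fun _ => hs _)
      (fun i => j i.castSucc) (fun m => a (Fin.snoc m (M * k + j (Fin.last n))))).trans ?_
    refine lpSum_comp (φ := fun k => M * k + j (Fin.last n)) ?_
      (fun k => mixedSeq n (fun i => s i.castSucc) fun m => a (Fin.snoc m k))
    intro x y h
    simpa [hM.ne'] using h

lemma mixedE_mono_ae : ∀ (n : ℕ) (p : Fin n → ℝ≥0∞) (_ : ∀ i, 1 ≤ p i)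
    {g h : (Fin n → ℝ) → ℝ≥0∞} (_ : ∀ᵐ x, g x ≤ h x), mixedE n p g ≤ mixedE n p h
  | 0, _, _, g, h, H => by
    simp only [mixedE]
    have : (volume : Measure (Fin 0 → ℝ)) = Measure.dirac Fin.elim0 := by
      rw [volume_pi]; exact Measure.pi_of_empty _ _
    rw [this, ae_dirac_eq] at H
    exact H
  | n + 1, p, hp, g, h, H => by
    simp only [mixedE]
    refine lpInt_mono_ae (hp _) ?_
    have e := (volume_preserving_piFinSuccAbove (fun _ : Fin (n+1) => ℝ) (Fin.last n)).symm
    have H2 := e.quasiMeasurePreserving.ae H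
    have H3 := Measure.ae_ae_of_ae_prod H2
    filter_upwards [H3] with t ht
    refine mixedE_mono_ae n _ (fun _ => hp _) ?_
    filter_upwards [ht] with x hx
    simpa [MeasurableEquiv.piFinSuccAbove, Fin.snocEquiv] using hx

lemma mixedE_mono (n : ℕ) (p : Fin n → ℝ≥0∞) (hp : ∀ i, 1 ≤ p i)
    {g h : (Fin n → ℝ) → ℝ≥0∞} (H : ∀ x, g x ≤ h x) : mixedE n p g ≤ mixedE n p h :=
  mixedE_mono_ae n p hp (Eventually.of_forall H)

lemma measurable_lpInt {α : Type*} [MeasurableSpace α] (p : ℝ≥0∞)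
    {G : α × ℝ → ℝ≥0∞} (hG : Measurable G) : Measurable fun a => lpInt p (fun t => G (a, t)) := by
  unfold lpInt
  split_ifs
  · refine measurable_of_Iic fun c => ?_
    have : (fun a => essSup (fun t => G (a, t)) volume) ⁻¹' Iic c =
        (fun a => volume (Prod.mk a ⁻¹' (G ⁻¹' Ioi c))) ⁻¹' {0} := by
      ext a
      simp only [mem_preimage, mem_Iic, mem_singleton_iff]
      constructor
      · intro h
        have := ENNReal.ae_le_essSup (μ := volume) (fun t => G (a, t))
        have h2 : ∀ᵐ t, G (a, t) ≤ c := this.mono fun t ht => ht.trans h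
        rw [ae_iff] at h2
        simpa [preimage, not_le] using h2
      · intro h
        refine essSup_le_of_ae_le _ ?_
        change ∀ᵐ t, G (a, t) ≤ c
        rw [ae_iff]
        simpa [preimage, not_le] using h
    rw [this]
    exact measurable_measure_prodMk_left (hG measurableSet_Ioi) (measurableSet_singleton _)
  · exact ((hG.pow_const _).lintegral_prod_right').pow_const _

lemma measurable_snoc (n : ℕ) :
    Measurable fun z : (Fin n → ℝ) × ℝ => (Fin.snoc z.1 z.2 : Fin (n+1) → ℝ) := by
  refine measurable_pi_lambda _ fun i => ?_
  refine Fin.lastCases ?_ (fun j => ?_) i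
  · simpa using measurable_snd
  · simpa [Function.comp_def] using (measurable_pi_apply j).comp (measurable_fst (α := Fin n → ℝ) (β := ℝ))

lemma measurable_mixedE : ∀ (n : ℕ) (p : Fin n → ℝ≥0∞) {α : Type} [MeasurableSpace α]
    {G : α × (Fin n → ℝ) → ℝ≥0∞} (_ : Measurable G),
    Measurable fun a => mixedE n p (fun x => G (a, x))
  | 0, _, _, _, _, hG => hG.comp (measurable_id.prodMk measurable_const)
  | n + 1, p, α, _, G, hG => by
    simp only [mixedE]
    refine measurable_lpInt _ (G := fun z : α × ℝ => mixedE n (fun i => p i.castSucc)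
      fun x => G (z.1, Fin.snoc x z.2)) ?_
    refine measurable_mixedE n _ (G := fun w : (α × ℝ) × (Fin n → ℝ) =>
      G (w.1.1, Fin.snoc w.2 w.1.2)) ?_
    refine hG.comp (Measurable.prodMk (by fun_prop) ?_)
    exact (measurable_snoc n).comp (g := fun z : (Fin n → ℝ) × ℝ => (Fin.snoc z.1 z.2 : Fin (n+1) → ℝ))
      (f := fun w : (α × ℝ) × (Fin n → ℝ) => (w.2, w.1.2)) (by fun_prop)

lemma mixedE_add : ∀ (n : ℕ) (p : Fin n → ℝ≥0∞) (_ : ∀ i, 1 ≤ p i)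
    {g h : (Fin n → ℝ) → ℝ≥0∞} (_ : Measurable g) (_ : Measurable h),
    mixedE n p (fun x => g x + h x) ≤ mixedE n p g + mixedE n p h
  | 0, _, _, _, _, _, _ => le_rfl
  | n + 1, p, hp, g, h, hg, hh => by
    have hm : ∀ t : ℝ, Measurable fun x : Fin n → ℝ => (Fin.snoc x t : Fin (n+1) → ℝ) :=
      fun t => (measurable_snoc n).comp (g := fun z : (Fin n → ℝ) × ℝ => (Fin.snoc z.1 z.2 : Fin (n+1) → ℝ))
        (f := fun w : Fin n → ℝ => (w, t)) (by fun_prop)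
    have hm2 : Measurable fun w : ℝ × (Fin n → ℝ) => (Fin.snoc w.2 w.1 : Fin (n+1) → ℝ) :=
      (measurable_snoc n).comp (g := fun z : (Fin n → ℝ) × ℝ => (Fin.snoc z.1 z.2 : Fin (n+1) → ℝ))
        (f := fun w : ℝ × (Fin n → ℝ) => (w.2, w.1)) (by fun_prop)
    simp only [mixedE]
    refine (lpInt_mono_ae (hp _) (Eventually.of_forall fun t => mixedE_add n _ (fun _ => hp _)
      (hg.comp (hm t)) (hh.comp (hm t)))).trans ?_
    rw [lpInt_eq (hp _), lpInt_eq (hp _), lpInt_eq (hp _)]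
    exact eLpNorm_add_le
      (measurable_mixedE n _ (hg.comp hm2)).aestronglyMeasurable
      (measurable_mixedE n _ (hh.comp hm2)).aestronglyMeasurable (hp _)

lemma mixedE_sum {ι : Type*} (n : ℕ) (p : Fin n → ℝ≥0∞) (hp : ∀ i, 1 ≤ p i)
    (J : Finset ι) (g : ι → (Fin n → ℝ) → ℝ≥0∞) (hg : ∀ j, Measurable (g j)) :
    mixedE n p (fun k => ∑ j ∈ J, g j k) ≤ ∑ j ∈ J, mixedE n p (g j) := by
  classical
  induction J using Finset.induction_on with
  | empty => simp [mixedE_zero n p hp]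
  | insert i J hi ih =>
    simp_rw [Finset.sum_insert hi]
    exact (mixedE_add n p hp (hg i) (Finset.measurable_sum _ fun j _ => hg j)).trans (by gcongr)

lemma mixedLp_mono (n : ℕ) (p : Fin n → ℝ≥0∞) (hp : ∀ i, 1 ≤ p i) {S T : Set (Fin n → ℝ)}
    (h : S ⊆ T) (f : (Fin n → ℝ) → ℝ) :
    mixedLp n p (S.indicator f) ≤ mixedLp n p (T.indicator f) := by
  refine mixedE_mono n p hp fun x => ?_
  by_cases hx : x ∈ S
  · simp [hx, h hx]
  · simp [hx]

lemma mixedLp_cover {ι : Type*} (n : ℕ) (p : Fin n → ℝ≥0∞) (hp : ∀ i, 1 ≤ p i)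
    (J : Finset ι) (S : Set (Fin n → ℝ)) (T : ι → Set (Fin n → ℝ))
    (hT : ∀ j, MeasurableSet (T j)) (hST : ∀ x ∈ S, ∃ j ∈ J, x ∈ T j)
    {f : (Fin n → ℝ) → ℝ} (hf : AEStronglyMeasurable f volume) :
    mixedLp n p (S.indicator f) ≤ ∑ j ∈ J, mixedLp n p ((T j).indicator f) := by
  obtain ⟨g, hg, hfg⟩ := hf
  have h1 : mixedLp n p (S.indicator f) ≤
      mixedE n p (fun x => ∑ j ∈ J, (‖(T j).indicator g x‖₊ : ℝ≥0∞)) := by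
    refine mixedE_mono_ae n p hp ?_
    filter_upwards [hfg] with x hx
    by_cases hxS : x ∈ S
    · obtain ⟨j, hj, hxj⟩ := hST x hxS
      refine le_trans ?_ (Finset.single_le_sum (f := fun j => (‖(T j).indicator g x‖₊ : ℝ≥0∞))
        (fun _ _ => zero_le) hj)
      simp [hxS, hxj, hx]
    · simp [hxS]
  refine h1.trans ((mixedE_sum n p hp J _ fun j =>
    ((hg.measurable.indicator (hT j)).nnnorm).coe_nnreal_ennreal).trans ?_)
  refine Finset.sum_le_sum fun j _ => mixedE_mono_ae n p hp ?_
  filter_upwards [hfg] with x hx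
  simp [indicator, hx]

lemma measurableSet_qcube (n : ℕ) (r : ℝ) (k : Fin n → ℤ) : MeasurableSet (qcube n r k) := by
  have : qcube n r k = Set.pi univ fun i => Ico (r * (k i : ℝ)) (r * ((k i : ℝ) + 1)) := by
    ext x; simp [qcube]
  rw [this]
  exact MeasurableSet.univ_pi fun i => measurableSet_Ico

lemma mem_qcube_iff (n : ℕ) {r : ℝ} (hr : 0 < r) (k : Fin n → ℤ) (x : Fin n → ℝ) :
    x ∈ qcube n r k ↔ ∀ i, ⌊x i / r⌋ = k i := by
  simp only [qcube, mem_ofPred_eq, Int.floor_eq_iff, le_div_iff₀ hr, div_lt_iff₀ hr, mul_comm r]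

lemma ball_cover (n : ℕ) {r : ℝ} (hr : 0 < r) (y x : Fin n → ℝ) (hx : x ∈ eball n y r) :
    ∃ j ∈ Fintype.piFinset (fun _ : Fin n => Finset.Icc (-1 : ℤ) 1),
      x ∈ qcube n r (fun i => 1 * ⌊y i / r⌋ + j i) := by
  refine ⟨fun i => ⌊x i / r⌋ - ⌊y i / r⌋, ?_, ?_⟩
  · rw [Fintype.mem_piFinset]
    intro i
    have h1 : |x i - y i| < r := by
      refine lt_of_le_of_lt ?_ hx
      rw [← Real.sqrt_sq_eq_abs]
      exact Real.sqrt_le_sqrt (Finset.single_le_sum (f := fun i => (x i - y i) ^ 2)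
        (fun _ _ => sq_nonneg _) (Finset.mem_univ i))
    have h2 : |x i / r - y i / r| < 1 := by
      rw [← sub_div, abs_div, abs_of_pos hr, div_lt_one hr]; exact h1
    rw [abs_lt] at h2
    have a1 := Int.floor_le (x i / r)
    have a2 := Int.lt_floor_add_one (x i / r)
    have a3 := Int.floor_le (y i / r)
    have a4 := Int.lt_floor_add_one (y i / r)
    rw [Finset.mem_Icc]
    constructor
    · have : ((⌊y i / r⌋ : ℤ) : ℝ) < ⌊x i / r⌋ + 2 := by linarith
      have : (⌊y i / r⌋ : ℤ) < ⌊x i / r⌋ + 2 := by exact_mod_cast this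
      omega
    · have : ((⌊x i / r⌋ : ℤ) : ℝ) < ⌊y i / r⌋ + 2 := by linarith
      have : (⌊x i / r⌋ : ℤ) < ⌊y i / r⌋ + 2 := by exact_mod_cast this
      omega
  · rw [mem_qcube_iff n hr]
    intro i; ring

lemma cube_cover (n : ℕ) {r : ℝ} (hr : 0 < r) (N : ℕ) (hN : 0 < N) (k : Fin n → ℤ)
    (x : Fin n → ℝ) (hx : x ∈ qcube n r k) :
    ∃ j ∈ Fintype.piFinset (fun _ : Fin n => Finset.Ico (0 : ℤ) N),
      x ∈ qcube n (r / N) (fun i => N * k i + j i) := by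
  have hN' : (0 : ℝ) < N := by exact_mod_cast hN
  have hd : 0 < r / N := by positivity
  refine ⟨fun i => ⌊x i / (r / N)⌋ - N * k i, ?_, ?_⟩
  · rw [Fintype.mem_piFinset]
    intro i
    obtain ⟨h1, h2⟩ := hx i
    rw [Finset.mem_Ico]
    have e : x i / (r / N) = N * (x i / r) := by field_simp
    have h3 : (k i : ℝ) ≤ x i / r := by rw [le_div_iff₀ hr]; linarith
    have h4 : x i / r < k i + 1 := by rw [div_lt_iff₀ hr]; linarith
    constructor
    · have : (N : ℤ) * k i ≤ ⌊x i / (r / N)⌋ := by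
        rw [Int.le_floor, e]; push_cast; gcongr
      omega
    · have : ⌊x i / (r / N)⌋ < (N : ℤ) * k i + N := by
        rw [Int.floor_lt, e]; push_cast; nlinarith
      omega
  · rw [mem_qcube_iff n hd]
    intro i; ring

lemma cube_subset_ball (n : ℕ) {r : ℝ} (hr : 0 < r) (y : Fin n → ℝ) :
    qcube n (r / (n + 1 : ℕ)) (fun i => ⌊y i / (r / (n + 1 : ℕ))⌋) ⊆ eball n y r := by
  intro x hx
  have hN' : (0 : ℝ) < (n + 1 : ℕ) := by positivity
  set d := r / (n + 1 : ℕ) with hd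
  have hdp : 0 < d := by positivity
  have hr' : r = d * (n + 1) := by rw [hd]; push_cast; field_simp
  have hy : y ∈ qcube n d (fun i => ⌊y i / d⌋) := (mem_qcube_iff n hdp _ _).2 fun i => rfl
  have h1 : ∀ i, (x i - y i) ^ 2 ≤ d ^ 2 := by
    intro i
    obtain ⟨a, b⟩ := hx i
    obtain ⟨a', b'⟩ := hy i
    rw [sq_le_sq, abs_of_pos hdp, abs_le]
    constructor <;> nlinarith
  have h2 : ∑ i, (x i - y i) ^ 2 ≤ n * d ^ 2 := by
    refine (Finset.sum_le_sum fun i _ => h1 i).trans ?_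
    simp
  change Real.sqrt _ < r
  rw [Real.sqrt_lt' hr]
  refine h2.trans_lt ?_
  rw [hr']
  have : (0 : ℝ) ≤ n := by positivity
  have : 0 < d ^ 2 := by positivity
  nlinarith [mul_nonneg ‹(0:ℝ) ≤ n› this.le, mul_nonneg (mul_nonneg ‹(0:ℝ) ≤ n› ‹(0:ℝ) ≤ n›) this.le]

/-- The discrete norm over cubes `Q_{r,k}` is equivalent to
`r^{-Σᵢ 1/sᵢ}` times the continuous amalgam norm over balls of radius `r`,
uniformly in `r` and `f`. -/
theorem statement5 (n : ℕ) (hn : 1 ≤ n) (p s : Fin n → ℝ≥0∞)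
    (hp : ∀ i, 1 ≤ p i) (hs : ∀ i, 1 ≤ s i) :
    ∃ c C : ℝ≥0∞, 0 < c ∧ c ≤ C ∧ C < ∞ ∧
      ∀ r : ℝ, 0 < r → ∀ f : (Fin n → ℝ) → ℝ, LocallyIntegrable f volume →
        c * (ENNReal.ofReal (r ^ (-(invSum n s))) * amalgamNormR n p s r f) ≤
            discNormR n p s r f ∧
        discNormR n p s r f ≤
            C * (ENNReal.ofReal (r ^ (-(invSum n s))) * amalgamNormR n p s r f) := by
  set J1 := Fintype.piFinset (fun _ : Fin n => Finset.Icc (-1 : ℤ) 1) with hJ1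
  set J2 := Fintype.piFinset (fun _ : Fin n => Finset.Ico (0 : ℤ) (n + 1 : ℕ)) with hJ2
  set S := invSum n s with hS
  set K : ℝ := ((n + 1 : ℕ) : ℝ) ^ S with hK
  refine ⟨((J1.card : ℝ≥0∞) + 1)⁻¹, J2.card * ENNReal.ofReal K + 1, ?_, ?_, ?_, ?_⟩
  · exact ENNReal.inv_pos.2 (by simp)
  · refine le_trans (ENNReal.inv_le_one.2 ?_) ?_ <;> exact le_add_self
  · exact ENNReal.add_lt_top.2 ⟨ENNReal.mul_lt_top (by simp) (by simp), by simp⟩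
  intro r hr f hf
  have hfm := hf.aestronglyMeasurable
  constructor
  · have h1 : amalgamNormR n p s r f ≤
        ENNReal.ofReal (r ^ S) * (J1.card * discNormR n p s r f) := by
      have h2 : amalgamNormR n p s r f ≤ mixedE n s (fun y =>
          (fun k : Fin n → ℤ => ∑ j ∈ J1, mixedLp n p
            ((qcube n r (fun i => 1 * k i + j i)).indicator f)) (fun i => ⌊y i / r⌋)) := by
        refine mixedE_mono n s hs fun y => ?_
        exact mixedLp_cover n p hp J1 _ _ (fun j => measurableSet_qcube n r _)
          (fun x hx => ball_cover n hr y x hx) hfm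
      refine h2.trans ?_
      refine (mixedE_step hr n s hs (fun k : Fin n → ℤ => ∑ j ∈ J1, mixedLp n p
            ((qcube n r (fun i => 1 * k i + j i)).indicator f))).le.trans ?_
      gcongr
      refine (mixedSeq_sum n s hs J1 _).trans ?_
      refine (Finset.sum_le_sum fun j _ => mixedSeq_comp one_pos n s hs j
        (fun k => mixedLp n p ((qcube n r k).indicator f))).trans ?_
      simp [discNormR]
    calc _ ≤ ((J1.card : ℝ≥0∞) + 1)⁻¹ * (ENNReal.ofReal (r ^ (-S)) *
            (ENNReal.ofReal (r ^ S) * (J1.card * discNormR n p s r f))) := by gcongr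
      _ = ((J1.card : ℝ≥0∞) + 1)⁻¹ * (J1.card * discNormR n p s r f) := by
          rw [← mul_assoc (ENNReal.ofReal (r ^ (-S))), ← ENNReal.ofReal_mul (by positivity),
            ← Real.rpow_add hr]
          simp
      _ ≤ ((J1.card : ℝ≥0∞) + 1)⁻¹ * ((J1.card + 1) * discNormR n p s r f) := by
          gcongr; exact le_self_add
      _ = discNormR n p s r f := by
          rw [← mul_assoc, ENNReal.inv_mul_cancel (by simp) (by simp), one_mul]
  · set d := r / (n + 1 : ℕ) with hd
    have hN : (0 : ℝ) < (n + 1 : ℕ) := by positivity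
    have hdp : 0 < d := by positivity
    have h1 : ENNReal.ofReal (d ^ S) * discNormR n p s d f ≤ amalgamNormR n p s r f := by
      rw [discNormR, ← mixedE_step hdp n s hs]
      refine mixedE_mono n s hs fun y => ?_
      exact mixedLp_mono n p hp (cube_subset_ball n hr y) f
    have h2 : discNormR n p s r f ≤ J2.card * discNormR n p s d f := by
      refine (mixedSeq_mono n s hs (b := fun k => ∑ j ∈ J2, mixedLp n p
            ((qcube n d (fun i => (n + 1 : ℕ) * k i + j i)).indicator f)) fun k =>
        mixedLp_cover n p hp J2 _ _ (fun j => measurableSet_qcube n d _)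
          (fun x hx => cube_cover n hr (n + 1) (Nat.succ_pos n) k x hx) hfm).trans ?_
      refine (mixedSeq_sum n s hs J2 _).trans ?_
      refine (Finset.sum_le_sum fun j _ => mixedSeq_comp (M := (n + 1 : ℕ)) (by positivity)
        n s hs j (fun k => mixedLp n p ((qcube n d k).indicator f))).trans ?_
      simp [discNormR]
    have h3 : K * r ^ (-S) * d ^ S = 1 := by
      rw [hd, hK, Real.div_rpow hr.le hN.le, Real.rpow_neg hr.le]
      have : r ^ S ≠ 0 := by positivity
      have : ((n + 1 : ℕ) : ℝ) ^ S ≠ 0 := by positivity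
      field_simp
    calc _ ≤ J2.card * discNormR n p s d f := h2
      _ = J2.card * (ENNReal.ofReal (K * r ^ (-S) * d ^ S) * discNormR n p s d f) := by
          rw [h3]; simp
      _ = J2.card * ENNReal.ofReal K * (ENNReal.ofReal (r ^ (-S)) *
            (ENNReal.ofReal (d ^ S) * discNormR n p s d f)) := by
          rw [ENNReal.ofReal_mul (by positivity), ENNReal.ofReal_mul (by positivity)]; ring
      _ ≤ J2.card * ENNReal.ofReal K * (ENNReal.ofReal (r ^ (-S)) * amalgamNormR n p s r f) := by
          gcongr
      _ ≤ _ := by gcongr; exact le_self_add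


end MixedAmalgam

end
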